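/- For every ε with 0 ≤ ε < 1 and every general source X, the infimum ε-achievable overflow threshold satisfies R(ε|X) = inf{ R : F(R) ≤ ε }, where F(R) = limsup_{n→∞} Pr{ (1/(n α_c)) log_K (1/P_{X^n}(X^n)) ≥ R }. -/

import Mathlib

open scoped BigOperators

/-- Cost of a string `l` over the code alphabet `Fin K`: the sum of the conditional
per-symbol costs `c (l.get i) (prefix before position i)`. -/
noncomputable def strCost {K : ℕ} (c : Fin K → List (Fin K) → ℝ) (l : List (Fin K)) : ℝ :=
  ∑ i : Fin l.length, c (l.get i) (l.take i.val)

/-- Probability of the set `S` under the probability mass function `P`. -/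
noncomputable def prSet {α : Type*} (P : α → ℝ) (S : Set α) : ℝ :=
  ∑' x, S.indicator P x

open Filter Topology

theorem strCost_append_singleton {K : ℕ} (c : Fin K → List (Fin K) → ℝ) (l : List (Fin K))
    (u : Fin K) : strCost c (l ++ [u]) = strCost c l + c u l := by
  have key : ∀ l : List (Fin K), strCost c l =
      ∑ i ∈ Finset.range l.length, if h : i < l.length then c l[i] (l.take i) else 0 := by
    intro l
    rw [Finset.sum_range]
    exact Finset.sum_congr rfl fun i _ => by simp
  rw [key, key, show Finset.range (l ++ [u]).length = Finset.range (l.length + 1) by simp,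
    Finset.sum_range_succ]
  congr 1
  · refine Finset.sum_congr rfl fun i hi => ?_
    have hi' : i < l.length := Finset.mem_range.mp hi
    have hi'' : i < (l ++ [u]).length := by simp; omega
    rw [dif_pos hi'', dif_pos hi', List.getElem_append_left hi',
      List.take_append_of_le_length hi'.le]
  · simp

theorem strCost_pos {K : ℕ} {c : Fin K → List (Fin K) → ℝ} (hc : ∀ u s, 0 < c u s)
    {l : List (Fin K)} (hl : l ≠ []) : 0 < strCost c l := by
  have : Nonempty (Fin l.length) := ⟨⟨0, List.length_pos_iff.mpr hl⟩⟩
  exact Finset.sum_pos (fun i _ => hc _ _) Finset.univ_nonempty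

theorem exists_inv_le_cost {K : ℕ} (hK : 2 ≤ K) {c : Fin K → List (Fin K) → ℝ} {a : ℝ}
    (ha : 0 < a) (s : List (Fin K)) (hcap : ∑ u : Fin K, (K : ℝ) ^ (-(a * c u s)) = 1) :
    ∃ u, 1 / a ≤ c u s := by
  have hK1 : (1 : ℝ) < K := by exact_mod_cast hK
  by_contra! h
  have hlt : ∀ u : Fin K, (K : ℝ)⁻¹ < (K : ℝ) ^ (-(a * c u s)) := by
    intro u
    rw [← Real.rpow_neg_one]
    apply Real.rpow_lt_rpow_of_exponent_lt hK1
    have := (lt_div_iff₀' ha).mp (h u)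
    linarith
  have hne : (Finset.univ : Finset (Fin K)).Nonempty := ⟨⟨0, by omega⟩, Finset.mem_univ _⟩
  have := Finset.sum_lt_sum_of_nonempty hne fun u _ => hlt u
  rw [hcap] at this
  simp only [Finset.sum_const, Finset.card_univ, Fintype.card_fin, nsmul_eq_mul] at this
  rw [mul_inv_cancel₀ (by positivity)] at this
  exact lt_irrefl _ this

/-- Every nonnegative target is approximated from above, within `cmax`, by the cost of a
nonempty string. -/
theorem exists_strCost_mem_Icc {K : ℕ} (hK : 2 ≤ K) {c : Fin K → List (Fin K) → ℝ} {cmax a : ℝ}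
    (hcmax : ∀ u s, c u s ≤ cmax) (ha : 0 < a)
    (hcap : ∀ s, ∑ u : Fin K, (K : ℝ) ^ (-(a * c u s)) = 1) {t : ℝ} (ht : 0 ≤ t) :
    ∃ l : List (Fin K), l ≠ [] ∧ strCost c l ∈ Set.Icc t (t + cmax) := by
  classical
  choose f hf using fun s => exists_inv_le_cost hK ha s (hcap s)
  let g : ℕ → List (Fin K) := fun n => Nat.rec [] (fun _ l => l ++ [f l]) n
  have hg : ∀ n, g (n + 1) = g n ++ [f (g n)] := fun _ => rfl
  have h0 : strCost c (g 0) = 0 := by simp [g, strCost]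
  have hgrow : ∀ n : ℕ, n * (1 / a) ≤ strCost c (g n) := by
    intro n
    induction n with
    | zero => simp [h0]
    | succ n ih =>
      rw [hg, strCost_append_singleton]
      push_cast
      linarith [hf (g n)]
  have hex : ∃ n, t ≤ strCost c (g (n + 1)) := by
    obtain ⟨n, hn⟩ := exists_nat_gt (t * a)
    refine ⟨n, le_trans ?_ (hgrow (n + 1))⟩
    rw [mul_one_div, le_div_iff₀ ha]
    push_cast
    linarith
  have hlast : strCost c (g (Nat.find hex)) ≤ t := by
    rcases hm : Nat.find hex with _ | m
    · rw [h0]; exact ht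
    · exact (not_le.mp (Nat.find_min hex (m := m) (by omega))).le
  refine ⟨g (Nat.find hex + 1), by simp [hg], Nat.find_spec hex, ?_⟩
  rw [hg, strCost_append_singleton]
  exact add_le_add hlast (hcmax _ _)

/-- An encoder whose cost exceeds the normalized self-information by at most a constant. -/
theorem exists_encoder_strCost_le {K : ℕ} (hK : 2 ≤ K) {c : Fin K → List (Fin K) → ℝ}
    {cmax a : ℝ} (hcmax : ∀ u s, c u s ≤ cmax) (ha : 0 < a)
    (hcap : ∀ s, ∑ u : Fin K, (K : ℝ) ^ (-(a * c u s)) = 1)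
    {α : Type*} [Countable α] {p : α → ℝ} (hp : ∀ x, 0 ≤ p x) (hsum : HasSum p 1) :
    ∃ φ : α → List (Fin K), (∀ x, φ x ≠ []) ∧
      ∑' x, ENNReal.ofReal ((K : ℝ) ^ (-(a * strCost c (φ x)))) ≤ 1 ∧
      ∀ x, 0 < p x →
        strCost c (φ x) ≤ 1 / a * Real.logb K (1 / p x) + (1 / a * Real.logb K 2 + cmax) := by
  have hK1 : (1 : ℝ) < K := by exact_mod_cast hK
  obtain ⟨g, hgpos, s, hgs, hs1⟩ := NNReal.exists_pos_sum_of_countable one_ne_zero α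
  have hgs' : HasSum (fun x => (g x : ℝ)) s := NNReal.hasSum_coe.mpr hgs
  have hs1' : (s : ℝ) < 1 := by exact_mod_cast hs1
  set q : α → ℝ := fun x => (p x + g x) / 2 with hq
  have hqs : HasSum q ((1 + s) / 2) := (hsum.add hgs').div_const 2
  have hqpos : ∀ x, 0 < q x := fun x =>
    div_pos (add_pos_of_nonneg_of_pos (hp x) (by exact_mod_cast hgpos x)) two_pos
  have hq1 : ∀ x, q x ≤ 1 := fun x =>
    (le_hasSum hqs x fun y _ => (hqpos y).le).trans (by linarith)
  have ht : ∀ x, 0 ≤ 1 / a * Real.logb K (1 / q x) := fun x =>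
    mul_nonneg (by positivity) (Real.logb_nonneg hK1 ((one_le_div (hqpos x)).mpr (hq1 x)))
  choose φ hφ hφl hφu using fun x => exists_strCost_mem_Icc hK hcmax ha hcap (ht x)
  refine ⟨φ, hφ, ?_, fun x hx => (hφu x).trans ?_⟩
  · calc ∑' x, ENNReal.ofReal ((K : ℝ) ^ (-(a * strCost c (φ x))))
        ≤ ∑' x, ENNReal.ofReal (q x) := by
          refine ENNReal.tsum_le_tsum fun x => ENNReal.ofReal_le_ofReal ?_
          rw [← Real.le_logb_iff_rpow_le hK1 (hqpos x)]
          have := mul_le_mul_of_nonneg_left (hφl x) ha.le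
          rw [← mul_assoc, mul_one_div_cancel ha.ne', one_mul, one_div, Real.logb_inv] at this
          linarith
      _ = ENNReal.ofReal (∑' x, q x) :=
          (ENNReal.ofReal_tsum_of_nonneg (fun x => (hqpos x).le) hqs.summable).symm
      _ ≤ 1 := by
          rw [hqs.tsum_eq]
          exact ENNReal.ofReal_le_one.mpr (by linarith)
  · have h1 : Real.logb K (1 / q x) ≤ Real.logb K (1 / p x) + Real.logb K 2 := by
      rw [← Real.logb_mul (by positivity) two_ne_zero]
      refine Real.logb_le_logb_of_le hK1 (by have := hqpos x; positivity) ?_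
      rw [one_div_mul_eq_div, div_le_div_iff₀ (hqpos x) hx]
      have : (0 : ℝ) ≤ g x := (g x).2
      simp only [hq]
      linarith
    have := mul_le_mul_of_nonneg_left h1 (one_div_nonneg.mpr ha.le)
    linarith

section PrSet

variable {α : Type*} {p : α → ℝ}

theorem prSet_le_prSet_of_imp (hp : ∀ x, 0 ≤ p x) (hs : Summable p) {S T : Set α}
    (h : ∀ x, 0 < p x → x ∈ S → x ∈ T) : prSet p S ≤ prSet p T := by
  refine Summable.tsum_le_tsum (fun x => ?_) (hs.indicator S) (hs.indicator T)
  by_cases hS : x ∈ S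
  · rcases (hp x).eq_or_lt with h0 | h0
    · simp [Set.indicator, ← h0]
    · simp [hS, h x h0 hS]
  · simpa [hS] using Set.indicator_nonneg (fun x _ => hp x) x

theorem prSet_nonneg (hp : ∀ x, 0 ≤ p x) (S : Set α) : 0 ≤ prSet p S :=
  tsum_nonneg fun _ => Set.indicator_nonneg (fun x _ => hp x) _

theorem prSet_univ (hsum : HasSum p 1) : prSet p Set.univ = 1 := by
  simp [prSet, hsum.tsum_eq]

theorem prSet_le_one (hp : ∀ x, 0 ≤ p x) (hsum : HasSum p 1) (S : Set α) : prSet p S ≤ 1 :=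
  (prSet_le_prSet_of_imp hp hsum.summable fun _ _ _ => Set.mem_univ _).trans_eq (prSet_univ hsum)

/-- If on `S \ T` the mass function is bounded by `r` times a subprobability, then the
probability of `S` exceeds that of `T` by at most `r`. -/
theorem prSet_le_prSet_add (hp : ∀ x, 0 ≤ p x) (hs : Summable p) {S T : Set α} {w : α → ℝ}
    (hw : ∀ x, 0 ≤ w x) (hw1 : ∑' x, ENNReal.ofReal (w x) ≤ 1) {r : ℝ} (hr : 0 ≤ r)
    (h : ∀ x, 0 < p x → x ∈ S → x ∉ T → p x ≤ r * w x) :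
    prSet p S ≤ prSet p T + r := by
  have hne : ∑' x, ENNReal.ofReal (w x) ≠ ⊤ := ne_top_of_le_ne_top ENNReal.one_ne_top hw1
  have hws : Summable w := by
    have := ENNReal.summable_toReal hne
    simpa only [ENNReal.toReal_ofReal (hw _)] using this
  have hw2 : ∑' x, w x ≤ 1 := by
    rw [← ENNReal.ofReal_tsum_of_nonneg hw hws] at hw1
    exact ENNReal.ofReal_le_one.mp hw1
  calc prSet p S ≤ ∑' x, (T.indicator p x + r * w x) := by
        refine Summable.tsum_le_tsum (fun x => ?_) (hs.indicator S)
          ((hs.indicator T).add (hws.mul_left r))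
        have h1 : 0 ≤ r * w x := mul_nonneg hr (hw x)
        have h2 : 0 ≤ T.indicator p x := Set.indicator_nonneg (fun x _ => hp x) x
        by_cases hS : x ∈ S
        · by_cases hT : x ∈ T
          · simpa [hS, hT] using h1
          · rcases (hp x).eq_or_lt with h0 | h0
            · simpa [Set.indicator, ← h0] using h1
            · simpa [hS, hT] using h x h0 hS hT
        · simpa [hS] using add_nonneg h2 h1
    _ = prSet p T + r * ∑' x, w x := by
        rw [Summable.tsum_add (hs.indicator T) (hws.mul_left r), tsum_mul_left, prSet]
    _ ≤ prSet p T + r := by nlinarith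

end PrSet

theorem limsup_le_of_eventually_le_add {u v b : ℕ → ℝ} {e : ℝ}
    (hu1 : ∀ n, u n ≤ 1) (hv : ∀ n, 0 ≤ v n) (hb : Tendsto b atTop (𝓝 0))
    (h : ∀ᶠ n in atTop, v n ≤ u n + b n) (hu : limsup u atTop ≤ e) : limsup v atTop ≤ e := by
  refine le_of_forall_pos_le_add fun δ hδ => ?_
  have hev : ∀ᶠ n in atTop, u n < e + δ / 2 :=
    eventually_lt_of_limsup_lt (by linarith)
      ((isBoundedUnder_of ⟨1, hu1⟩ : IsBoundedUnder (· ≤ ·) atTop u))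
  refine limsup_le_of_le ((isBoundedUnder_of ⟨0, hv⟩ :
    IsBoundedUnder (· ≥ ·) atTop v).isCoboundedUnder_le) ?_
  filter_upwards [hev, h, hb.eventually_lt_const (half_pos hδ)] with n h1 h2 h3
  linarith

theorem pos_of_limsup_prSet_le {β : ℕ → Type*} {P : (n : ℕ) → β n → ℝ}
    (hPsum : ∀ n, HasSum (P n) 1) {e : ℝ} (he : e < 1) {S : ℝ → (n : ℕ) → Set (β n)} {R : ℝ}
    (hS : R ≤ 0 → ∀ n, 1 ≤ n → S R n = Set.univ)
    (h : limsup (fun n => prSet (P n) (S R n)) atTop ≤ e) : 0 < R := by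
  by_contra! hR
  have : (fun n => prSet (P n) (S R n)) =ᶠ[atTop] fun _ => (1 : ℝ) := by
    filter_upwards [eventually_ge_atTop 1] with n hn
    rw [hS hR n hn, prSet_univ (hPsum n)]
  rw [limsup_congr this, limsup_const] at h
  linarith

theorem sInf_eq_sInf_of_forall_add_mem {A B : Set ℝ} (hA : BddBelow A) (hB : BddBelow B)
    (hAB : ∀ R ∈ A, ∀ δ > 0, R + δ ∈ B) (hBA : ∀ R ∈ B, ∀ δ > 0, R + δ ∈ A) :
    sInf A = sInf B := by
  have key : ∀ {A B : Set ℝ}, BddBelow B → A.Nonempty → (∀ R ∈ A, ∀ δ > 0, R + δ ∈ B) →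
      sInf B ≤ sInf A := fun hB hne h =>
    le_csInf hne fun R hR => le_of_forall_pos_le_add fun δ hδ => csInf_le hB (h R hR δ hδ)
  rcases A.eq_empty_or_nonempty with rfl | hne
  · rcases B.eq_empty_or_nonempty with rfl | ⟨R, hR⟩
    · rfl
    · exact absurd (hBA R hR 1 one_pos) (Set.notMem_empty _)
  · obtain ⟨R, hR⟩ := id hne
    exact le_antisymm (key hA ⟨_, hAB R hR 1 one_pos⟩ hBA) (key hB hne hAB)

/-- Theorem 1: the infimum `ε`-achievable overflow threshold equals
`inf { R | F(R) ≤ ε }`, where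
`F(R) = limsup_n Pr{ (1/(n αc)) log_K (1 / P_{X^n}(X^n)) ≥ R }`. -/
theorem first_order_overflow_threshold
    (K : ℕ) (hK : 2 ≤ K)
    (c : Fin K → List (Fin K) → ℝ) (cmax αc : ℝ)
    (hcpos : ∀ (u : Fin K) (s : List (Fin K)), 0 < c u s)
    (hcmax : ∀ (u : Fin K) (s : List (Fin K)), c u s ≤ cmax)
    (hαc : 0 < αc)
    (hcap : ∀ s : List (Fin K), ∑ u : Fin K, (K : ℝ) ^ (-(αc * c u s)) = 1)
    (𝓧 : Type) [Countable 𝓧]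
    (P : (n : ℕ) → (Fin n → 𝓧) → ℝ)
    (hPnn : ∀ n x, 0 ≤ P n x) (hPsum : ∀ n, HasSum (P n) 1)
    (ε : ℝ) (hε0 : 0 ≤ ε) (hε1 : ε < 1) :
    sInf {R : ℝ | ∃ φ : (n : ℕ) → (Fin n → 𝓧) → List (Fin K),
        (∀ n x, φ n x ≠ []) ∧
        (∀ n, ∑' x, ENNReal.ofReal ((K : ℝ) ^ (-(αc * strCost c (φ n x)))) ≤ 1) ∧
        Filter.limsup
          (fun n => prSet (P n) {x | strCost c (φ n x) > (n : ℝ) * R})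
          Filter.atTop ≤ ε}
    = sInf {R : ℝ |
        Filter.limsup
          (fun n : ℕ => prSet (P n)
            {x | (1 / ((n : ℝ) * αc)) * Real.logb K (1 / P n x) ≥ R})
          Filter.atTop ≤ ε} := by
  have hK1 : (1 : ℝ) < K := by exact_mod_cast hK
  have hlog : ∀ n x, 0 ≤ Real.logb K (1 / P n x) := by
    intro n x
    rcases (hPnn n x).eq_or_lt with h0 | h0
    · simp [← h0]
    · exact Real.logb_nonneg hK1
        ((one_le_div h0).mpr (le_hasSum (hPsum n) x fun y _ => hPnn n y))
  apply sInf_eq_sInf_of_forall_add_mem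
  · refine ⟨0, fun R ⟨φ, hne, _, h⟩ => ?_⟩
    refine (pos_of_limsup_prSet_le hPsum hε1
      (S := fun R n => {x | strCost c (φ n x) > (n : ℝ) * R}) (fun hR n _ => ?_) h).le
    refine Set.eq_univ_of_forall fun x => ?_
    exact (mul_nonpos_of_nonneg_of_nonpos n.cast_nonneg hR).trans_lt
      (strCost_pos hcpos (hne n x))
  · refine ⟨0, fun R h => ?_⟩
    refine (pos_of_limsup_prSet_le hPsum hε1
      (S := fun R n => {x | (1 / ((n : ℝ) * αc)) * Real.logb K (1 / P n x) ≥ R})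
      (fun hR n _ => ?_) h).le
    refine Set.eq_univ_of_forall fun x => ?_
    exact hR.trans (mul_nonneg (by positivity) (hlog n x))
  · rintro R ⟨φ, hne, hkraft, h⟩ δ hδ
    have hr : (K : ℝ) ^ (-(αc * δ)) < 1 :=
      Real.rpow_lt_one_of_one_lt_of_neg hK1 (neg_lt_zero.mpr (mul_pos hαc hδ))
    refine limsup_le_of_eventually_le_add
      (fun n => prSet_le_one (hPnn n) (hPsum n) _) (fun n => prSet_nonneg (hPnn n) _)
      (tendsto_pow_atTop_nhds_zero_of_lt_one (by positivity) hr) ?_ h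
    filter_upwards [eventually_ge_atTop 1] with n hn
    have hn' : (0 : ℝ) < n := by exact_mod_cast hn
    refine prSet_le_prSet_add (hPnn n) (hPsum n).summable (fun x => by positivity) (hkraft n)
      (by positivity) fun x hx hS hT => ?_
    simp only [Set.mem_ofPred_eq, ge_iff_le, gt_iff_lt, not_lt] at hS hT
    rw [← Real.rpow_natCast, ← Real.rpow_mul (by positivity), ← Real.rpow_add (by positivity),
      ← Real.logb_le_iff_le_rpow hK1 hx]
    rw [one_div_mul_eq_div, le_div_iff₀ (by positivity), one_div, Real.logb_inv] at hS
    have := mul_le_mul_of_nonneg_left hT hαc.le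
    linarith
  · intro R h δ hδ
    choose φ hne hkraft hle using fun n =>
      exists_encoder_strCost_le hK hcmax hαc hcap (hPnn n) (hPsum n)
    refine ⟨φ, hne, hkraft, ?_⟩
    refine limsup_le_of_eventually_le_add
      (fun n => prSet_le_one (hPnn n) (hPsum n) _) (fun n => prSet_nonneg (hPnn n) _)
      tendsto_const_nhds ?_ h
    obtain ⟨N, hN⟩ := exists_nat_ge ((1 / αc * Real.logb K 2 + cmax) / δ)
    rw [div_le_iff₀ hδ] at hN
    filter_upwards [eventually_ge_atTop (max N 1)] with n hn
    have hn' : (0 : ℝ) < n := by exact_mod_cast (le_max_right N 1).trans hn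
    have hnN : (N : ℝ) ≤ n := by exact_mod_cast (le_max_left N 1).trans hn
    rw [add_zero]
    refine prSet_le_prSet_of_imp (hPnn n) (hPsum n).summable fun x hx hS => ?_
    simp only [Set.mem_ofPred_eq, gt_iff_lt, ge_iff_le] at hS ⊢
    have h1 := mul_le_mul_of_nonneg_right hnN hδ.le
    have h2 : n * R ≤ 1 / αc * Real.logb K (1 / P n x) := by linarith [hle n x hx]
    rw [one_div_mul_eq_div, le_div_iff₀ hαc] at h2
    rw [one_div_mul_eq_div, le_div_iff₀ (by positivity)]
    linarith
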